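/- For every λ ∈ ℂ with cosh(λ+η/2) ≠ 0 and sinh(2λ) ≠ 0, the boundary creation operator 𝓑(λ) reduces to the operators of the periodic chain: 𝓑(λ) = (1/(2·cosh(λ+η/2)·sinh ξ⁺)) · (sinh(2λ+η)/sinh(2λ)) · [ sinh(λ−η/2+ξ⁺)·B(λ−η/2)·D(−λ−η/2) + sinh(λ+η/2−ξ⁺)·B(−λ−η/2)·D(λ−η/2) ]. -/

import Mathlib

open Complex Matrix

/-- The six-vertex `R`-matrix on `ℂ² ⊗ ℂ²`, in the ordered basis
`e₁⊗e₁, e₁⊗e₂, e₂⊗e₁, e₂⊗e₂` (encoded by pairs in `Fin 2 × Fin 2`). -/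
noncomputable def R6v (η lam : ℂ) : Matrix (Fin 2 × Fin 2) (Fin 2 × Fin 2) ℂ :=
  Matrix.of fun p q =>
    if p = q then (if p.1 = p.2 then sinh (lam + η) else sinh lam)
    else if p.1 = q.2 ∧ p.2 = q.1 then sinh η else 0

/-- `R_{0j}(λ)`: the six-vertex `R`-matrix acting on the auxiliary space `0` and
the `j`-th quantum space of `ℂ² ⊗ (ℂ²)^{⊗L}`, and as the identity elsewhere.
The quantum space `(ℂ²)^{⊗L}` is encoded by basis indices `Fin L → Fin 2`. -/
noncomputable def R0j (L : ℕ) (η lam : ℂ) (j : Fin L) :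
    Matrix (Fin 2 × (Fin L → Fin 2)) (Fin 2 × (Fin L → Fin 2)) ℂ :=
  Matrix.of fun p q =>
    R6v η lam (p.1, p.2 j) (q.1, q.2 j) *
      (if ∀ k, k ≠ j → p.2 k = q.2 k then 1 else 0)

/-- The inhomogeneous monodromy matrix `T(λ) = R_{0L}(λ−s_L)⋯R_{01}(λ−s_1)` as an
endomorphism of `ℂ² ⊗ (ℂ²)^{⊗L}`. -/
noncomputable def Tfull (L : ℕ) (η : ℂ) (s : Fin L → ℂ) (lam : ℂ) :
    Matrix (Fin 2 × (Fin L → Fin 2)) (Fin 2 × (Fin L → Fin 2)) ℂ :=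
  (((List.finRange L).reverse).map (fun j => R0j L η (lam - s j) j)).prod

/-- The monodromy matrix viewed as a `2×2` matrix
`T(λ) = [[A(λ),B(λ)],[C(λ),D(λ)]]` over the auxiliary space, with entries in
`End((ℂ²)^{⊗L})`. -/
noncomputable def Tmono (L : ℕ) (η : ℂ) (s : Fin L → ℂ) (lam : ℂ) :
    Matrix (Fin 2) (Fin 2) (Matrix (Fin L → Fin 2) (Fin L → Fin 2) ℂ) :=
  Matrix.of fun α β => Matrix.of fun v w => Tfull L η s lam (α, v) (β, w)

/-- `a(λ) = ∏_{l=1}^L sinh(λ−s_l+η)`. -/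
noncomputable def afun (η : ℂ) {L : ℕ} (s : Fin L → ℂ) (lam : ℂ) : ℂ :=
  ∏ l, sinh (lam - s l + η)

/-- `d(λ) = ∏_{l=1}^L sinh(λ−s_l)`. -/
noncomputable def dfun {L : ℕ} (s : Fin L → ℂ) (lam : ℂ) : ℂ :=
  ∏ l, sinh (lam - s l)

/-- The diagonal boundary matrix
`K(λ,ξ) = (1/(sinh ξ · cosh λ)) · diag(sinh(λ+ξ), −sinh(λ−ξ))`. -/
noncomputable def Kbdry (ξ lam : ℂ) : Matrix (Fin 2) (Fin 2) ℂ :=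
  (1 / (sinh ξ * cosh lam)) •
    Matrix.diagonal (fun i => if i = 0 then sinh (lam + ξ) else -sinh (lam - ξ))

/-- The right boundary matrix `K⁺(λ) = ½ · K(λ+η, ξ⁺)`. -/
noncomputable def Kplus (η ξp lam : ℂ) : Matrix (Fin 2) (Fin 2) ℂ :=
  (2 : ℂ)⁻¹ • Kbdry ξp (lam + η)

/-- The Pauli matrix `σʸ`, with entries regarded as scalar multiples of the identity
operator on `(ℂ²)^{⊗L}`. -/
noncomputable def sigmaYop (L : ℕ) :
    Matrix (Fin 2) (Fin 2) (Matrix (Fin L → Fin 2) (Fin L → Fin 2) ℂ) :=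
  (!![0, -I; I, 0]).map (algebraMap ℂ (Matrix (Fin L → Fin 2) (Fin L → Fin 2) ℂ))

/-- The monodromy matrix `U⁺(λ) = [[𝓐(λ),𝓑(λ)],[𝓒(λ),𝓓(λ)]]` of the right
reflection algebra, defined by
`U⁺(λ)ᵗ = T(λ−η/2)ᵗ · K⁺(λ−η/2)ᵗ · σʸ · T(−λ−η/2) · σʸ`. -/
noncomputable def Uplus (L : ℕ) (η : ℂ) (s : Fin L → ℂ) (ξp lam : ℂ) :
    Matrix (Fin 2) (Fin 2) (Matrix (Fin L → Fin 2) (Fin L → Fin 2) ℂ) :=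
  ((Tmono L η s (lam - η / 2)).transpose *
      ((Kplus η ξp (lam - η / 2)).transpose.map
        (algebraMap ℂ (Matrix (Fin L → Fin 2) (Fin L → Fin 2) ℂ))) *
      sigmaYop L * Tmono L η s (-lam - η / 2) * sigmaYop L).transpose

/-- An operator on the `j`-th factor of `(ℂ²)^{⊗L}`, extended by the identity. -/
def siteOp {L : ℕ} (j : Fin L) (M : Matrix (Fin 2) (Fin 2) ℂ) :
    Matrix (Fin L → Fin 2) (Fin L → Fin 2) ℂ :=
  Matrix.of fun v w => M (v j) (w j) * (if ∀ k, k ≠ j → v k = w k then 1 else 0)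

lemma agree_off_iff {L : ℕ} (j : Fin L) (v w : Fin L → Fin 2) :
    (∀ k, k ≠ j → v k = w k) ↔ ∃ b, Function.update v j b = w := by
  constructor
  · intro h
    refine ⟨w j, ?_⟩
    funext k
    rcases eq_or_ne k j with rfl | hk
    · simp
    · simpa [hk] using h k hk
  · rintro ⟨b, rfl⟩ k hk
    simp [hk]

lemma sum_agree_off {L : ℕ} (j : Fin L) (v : Fin L → Fin 2) (f : (Fin L → Fin 2) → ℂ) :
    ∑ w, (if ∀ k, k ≠ j → v k = w k then f w else 0) = ∑ b, f (Function.update v j b) := by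
  classical
  rw [← Finset.sum_filter, ← Finset.sum_image (f := f) (g := fun b => Function.update v j b)
    (s := Finset.univ) (fun a _ b _ h => Function.update_injective v j h)]
  congr 1
  ext w
  simp only [Finset.mem_filter, Finset.mem_univ, true_and, agree_off_iff, Finset.mem_image]

lemma siteOp_mul_apply {L : ℕ} (j : Fin L) (M : Matrix (Fin 2) (Fin 2) ℂ)
    (X : Matrix (Fin L → Fin 2) (Fin L → Fin 2) ℂ) (v w : Fin L → Fin 2) :
    (siteOp j M * X) v w = ∑ b, M (v j) b * X (Function.update v j b) w := by
  have h := sum_agree_off j v (fun u => M (v j) (u j) * X u w)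
  simp only [Function.update_self] at h
  rw [← h, Matrix.mul_apply]
  refine Finset.sum_congr rfl fun u _ => ?_
  simp only [siteOp, Matrix.of_apply]
  split_ifs <;> simp

lemma mul_siteOp_apply {L : ℕ} (j : Fin L) (M : Matrix (Fin 2) (Fin 2) ℂ)
    (X : Matrix (Fin L → Fin 2) (Fin L → Fin 2) ℂ) (v w : Fin L → Fin 2) :
    (X * siteOp j M) v w = ∑ b, X v (Function.update w j b) * M b (w j) := by
  have h := sum_agree_off j w (fun u => X v u * M (u j) (w j))
  simp only [Function.update_self] at h
  rw [← h, Matrix.mul_apply]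
  refine Finset.sum_congr rfl fun u _ => ?_
  simp only [siteOp, Matrix.of_apply, @eq_comm _ (u _)]
  split_ifs <;> simp

/-- `siteOp j` as a ring homomorphism. -/
def siteHom {L : ℕ} (j : Fin L) :
    Matrix (Fin 2) (Fin 2) ℂ →+* Matrix (Fin L → Fin 2) (Fin L → Fin 2) ℂ where
  toFun := siteOp j
  map_one' := by
    ext v w
    simp only [siteOp, Matrix.of_apply, Matrix.one_apply, ite_mul, one_mul, zero_mul, ← ite_and]
    refine if_congr ⟨fun ⟨h, h'⟩ => ?_, fun h => by simp [h]⟩ rfl rfl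
    funext k
    rcases eq_or_ne k j with rfl | hk
    exacts [h, h' k hk]
  map_mul' M N := by
    ext v w
    rw [siteOp_mul_apply]
    simp only [siteOp, Matrix.of_apply, Matrix.mul_apply, Function.update_self, Finset.sum_mul]
    refine Finset.sum_congr rfl fun b _ => ?_
    rw [mul_assoc]
    congr 3
    refine propext (forall₂_congr fun k hk => ?_)
    simp [hk]
  map_zero' := by
    ext v w
    simp [siteOp]
  map_add' M N := by
    ext v w
    simp only [siteOp, Matrix.of_apply, Matrix.add_apply, add_mul]

lemma siteHom_algebraMap {L : ℕ} (j : Fin L) (c : ℂ) :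
    siteHom j (algebraMap ℂ _ c) = algebraMap ℂ _ c := by
  have h : siteHom j (c • 1) = c • siteHom j 1 := by
    ext v w
    simp [siteHom, siteOp]
  rw [Algebra.algebraMap_eq_smul_one, h, map_one, Algebra.algebraMap_eq_smul_one]

lemma siteHom_commute {L : ℕ} {j k : Fin L} (hjk : j ≠ k) (M N : Matrix (Fin 2) (Fin 2) ℂ) :
    Commute (siteHom j M) (siteHom k N) := by
  change siteOp j M * siteOp k N = siteOp k N * siteOp j M
  ext v w
  rw [siteOp_mul_apply, mul_siteOp_apply, Finset.sum_eq_single (w j),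
    Finset.sum_eq_single (v j)]
  · simp only [siteOp, Matrix.of_apply, Function.update_of_ne hjk.symm]
    have : (∀ i, i ≠ k → Function.update v j (w j) i = w i) ↔
        ∀ i, i ≠ k → v i = Function.update w j (v j) i := by
      refine forall₂_congr fun i _ => ?_
      rcases eq_or_ne i j with rfl | hi
      · simp
      · simp [hi]
    simp only [this]
    ring
  · intro b _ hb
    simp only [siteOp, Matrix.of_apply]
    rw [if_neg fun h => hb (by simpa using (h j hjk).symm)]
    simp
  · simp
  · intro b _ hb
    simp only [siteOp, Matrix.of_apply]
    rw [if_neg fun h => hb (by simpa using h j hjk)]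
    simp
  · simp

lemma prod_intertwine {M ι : Type*} [Monoid M] (r : M) (f g : ι → M)
    (h : ∀ i, r * f i * g i = g i * f i * r) (hc : ∀ i j, i ≠ j → Commute (f i) (g j))
    (l : List ι) (hl : l.Nodup) :
    r * (l.map f).prod * (l.map g).prod = (l.map g).prod * (l.map f).prod * r := by
  induction l with
  | nil => simp
  | cons i l ih =>
    obtain ⟨hi, hl⟩ := List.nodup_cons.1 hl
    have hne : ∀ j ∈ l, j ≠ i := fun j hj hji => hi (hji ▸ hj)
    have h₁ : Commute (l.map f).prod (g i) := by
      refine Commute.list_prod_left _ _ fun x hx => ?_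
      obtain ⟨j, hj, rfl⟩ := List.mem_map.1 hx
      exact hc j i (hne j hj)
    have h₂ : Commute (f i) (l.map g).prod := by
      refine Commute.list_prod_right _ _ fun x hx => ?_
      obtain ⟨j, hj, rfl⟩ := List.mem_map.1 hx
      exact hc i j (hne j hj).symm
    simp only [List.map_cons, List.prod_cons]
    calc r * (f i * (l.map f).prod) * (g i * (l.map g).prod)
        = r * f i * ((l.map f).prod * g i) * (l.map g).prod := by simp only [mul_assoc]
      _ = (r * f i * g i) * (l.map f).prod * (l.map g).prod := by
        rw [h₁.eq]; simp only [mul_assoc]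
      _ = g i * f i * (r * (l.map f).prod * (l.map g).prod) := by
        rw [h]; simp only [mul_assoc]
      _ = g i * (f i * (l.map g).prod) * (l.map f).prod * r := by
        rw [ih hl]; simp only [mul_assoc]
      _ = g i * (l.map g).prod * (f i * (l.map f).prod) * r := by
        rw [h₂.eq]; simp only [mul_assoc]

/-- The action of an operator-valued `2×2` matrix on the first of two auxiliary spaces. -/
def auxFst (A : Type*) [Ring A] :
    Matrix (Fin 2) (Fin 2) A →+* Matrix (Fin 2 × Fin 2) (Fin 2 × Fin 2) A :=
  (Matrix.compRingEquiv (Fin 2) (Fin 2) A).toRingHom.comp (Matrix.scalar (Fin 2)).mapMatrix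

/-- The action of an operator-valued `2×2` matrix on the second of two auxiliary spaces. -/
def auxSnd (A : Type*) [Ring A] :
    Matrix (Fin 2) (Fin 2) A →+* Matrix (Fin 2 × Fin 2) (Fin 2 × Fin 2) A :=
  (Matrix.compRingEquiv (Fin 2) (Fin 2) A).toRingHom.comp (Matrix.scalar (Fin 2))

lemma auxFst_apply {A : Type*} [Ring A] (X : Matrix (Fin 2) (Fin 2) A) (p q : Fin 2 × Fin 2) :
    auxFst A X p q = if p.2 = q.2 then X p.1 q.1 else 0 := by
  simp [auxFst, Matrix.comp_apply, Matrix.diagonal_apply]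

lemma auxSnd_apply {A : Type*} [Ring A] (X : Matrix (Fin 2) (Fin 2) A) (p q : Fin 2 × Fin 2) :
    auxSnd A X p q = if p.1 = q.1 then X p.2 q.2 else 0 := by
  by_cases h : p.1 = q.1 <;>
    simp [auxSnd, Matrix.comp_apply, h]

lemma auxFst_map {A B : Type*} [Ring A] [Ring B] (φ : A →+* B) (X : Matrix (Fin 2) (Fin 2) A) :
    φ.mapMatrix (auxFst A X) = auxFst B (φ.mapMatrix X) := by
  ext p q
  simp [auxFst_apply, apply_ite φ]

lemma auxSnd_map {A B : Type*} [Ring A] [Ring B] (φ : A →+* B) (X : Matrix (Fin 2) (Fin 2) A) :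
    φ.mapMatrix (auxSnd A X) = auxSnd B (φ.mapMatrix X) := by
  ext p q
  simp [auxSnd_apply, apply_ite φ]

lemma auxFst_auxSnd_commute {A : Type*} [Ring A] (X Y : Matrix (Fin 2) (Fin 2) A)
    (h : ∀ a b c d, Commute (X a b) (Y c d)) : Commute (auxFst A X) (auxSnd A Y) := by
  ext ⟨a, b⟩ ⟨c, d⟩ : 1
  simp [Matrix.mul_apply, auxFst_apply, auxSnd_apply, Fintype.sum_prod_type, (h a c b d).eq]

/-- The local Lax operator: the six-vertex `R`-matrix as a `2×2` matrix over its first factor. -/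
noncomputable def lax (η u : ℂ) : Matrix (Fin 2) (Fin 2) (Matrix (Fin 2) (Fin 2) ℂ) :=
  (Matrix.compRingEquiv (Fin 2) (Fin 2) ℂ).symm (R6v η u)

/-- The six-vertex `R`-matrix with entries regarded as scalar operators in the algebra `A`. -/
noncomputable def R6vScalar (A : Type*) [Ring A] [Algebra ℂ A] (η u : ℂ) :
    Matrix (Fin 2 × Fin 2) (Fin 2 × Fin 2) A :=
  (algebraMap ℂ A).mapMatrix (R6v η u)

lemma sinh_mul_sinh_add (x y z : ℂ) :
    sinh x * sinh (y + z) = sinh y * sinh (x + z) + sinh z * sinh (x - y) := by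
  simp only [Complex.sinh_add, Complex.sinh_sub]
  ring

set_option maxHeartbeats 4000000 in
/-- The Yang–Baxter equation for the six-vertex `R`-matrix. -/
lemma lax_intertwine (η u v : ℂ) :
    R6vScalar (Matrix (Fin 2) (Fin 2) ℂ) η (u - v) * auxFst _ (lax η u) * auxSnd _ (lax η v) =
      auxSnd _ (lax η v) * auxFst _ (lax η u) *
        R6vScalar (Matrix (Fin 2) (Fin 2) ℂ) η (u - v) := by
  have h₁ := sinh_mul_sinh_add u (u - v) η
  have h₂ := sinh_mul_sinh_add (v + η) η (u - v)
  have h₃ := sinh_mul_sinh_add u v η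
  rw [sub_sub_cancel] at h₁
  rw [add_sub_cancel_right, add_comm η, show v + η + (u - v) = u + η by ring] at h₂
  ext ⟨a, b⟩ ⟨c, d⟩ e f
  fin_cases a <;> fin_cases b <;> fin_cases c <;> fin_cases d <;> fin_cases e <;> fin_cases f <;>
    simp [Matrix.mul_apply, Matrix.sum_apply, auxFst_apply, auxSnd_apply, R6vScalar, lax, R6v,
      Fintype.sum_prod_type, Matrix.algebraMap_matrix_apply] <;>
    first
    | ring1
    | linear_combination sinh η * h₁
    | linear_combination -sinh η * h₁
    | linear_combination sinh η * h₂
    | linear_combination -sinh η * h₂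
    | linear_combination sinh η * h₃
    | linear_combination -sinh η * h₃

lemma Tmono_eq_prod (L : ℕ) (η : ℂ) (s : Fin L → ℂ) (x : ℂ) :
    Tmono L η s x = ((List.finRange L).reverse.map
      fun j => (siteHom j).mapMatrix (lax η (x - s j))).prod := by
  have h : Tmono L η s x =
      (Matrix.compRingEquiv (Fin 2) (Fin L → Fin 2) ℂ).symm (Tfull L η s x) := rfl
  rw [h, Tfull, map_list_prod, List.map_map]
  rfl

/-- The exchange relation for the monodromy matrix. -/
lemma Tmono_intertwine (L : ℕ) (η : ℂ) (s : Fin L → ℂ) (x y : ℂ) :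
    R6vScalar (Matrix (Fin L → Fin 2) (Fin L → Fin 2) ℂ) η (x - y) *
        auxFst _ (Tmono L η s x) * auxSnd _ (Tmono L η s y) =
      auxSnd _ (Tmono L η s y) * auxFst _ (Tmono L η s x) *
        R6vScalar (Matrix (Fin L → Fin 2) (Fin L → Fin 2) ℂ) η (x - y) := by
  simp only [Tmono_eq_prod, map_list_prod, List.map_map]
  refine prod_intertwine _ _ _ (fun j => ?_) (fun i j hij => ?_) _
    (List.nodup_reverse.2 (List.nodup_finRange L))
  · have h := congrArg (siteHom j).mapMatrix (lax_intertwine η (x - s j) (y - s j))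
    have hR : (siteHom j).mapMatrix (R6vScalar (Matrix (Fin 2) (Fin 2) ℂ) η (x - y)) =
        R6vScalar (Matrix (Fin L → Fin 2) (Fin L → Fin 2) ℂ) η (x - y) := by
      ext p q : 1
      exact siteHom_algebraMap j _
    simpa only [Function.comp_apply, map_mul, auxFst_map, auxSnd_map, sub_sub_sub_cancel_right, hR] using h
  · exact auxFst_auxSnd_commute _ _ fun a b c d => siteHom_commute hij _ _

/-- The exchange relation between the operators `D` and `B` of the periodic chain. -/
lemma Tmono_D_mul_B (L : ℕ) (η : ℂ) (s : Fin L → ℂ) (x y : ℂ) :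
    sinh (x - y) • (Tmono L η s x 1 1 * Tmono L η s y 0 1) =
      sinh (x - y + η) • (Tmono L η s y 0 1 * Tmono L η s x 1 1) -
        sinh η • (Tmono L η s x 0 1 * Tmono L η s y 1 1) := by
  have h := congrFun₂ (Tmono_intertwine L η s x y) (1, 0) (1, 1)
  simp [Matrix.mul_apply, auxFst_apply, auxSnd_apply, R6vScalar, R6v, Fintype.sum_prod_type,
    Algebra.algebraMap_eq_smul_one] at h
  rw [← h]
  abel

lemma Uplus_zero_one (L : ℕ) (η : ℂ) (s : Fin L → ℂ) (ξp lam : ℂ) :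
    Uplus L η s ξp lam 0 1 =
      (1 / (2 * cosh (lam + η / 2) * sinh ξp)) •
        (sinh (lam + η / 2 + ξp) •
            (Tmono L η s (lam - η / 2) 0 1 * Tmono L η s (-lam - η / 2) 1 1) +
          sinh (lam + η / 2 - ξp) •
            (Tmono L η s (lam - η / 2) 1 1 * Tmono L η s (-lam - η / 2) 0 1)) := by
  have hη : lam - η / 2 + η = lam + η / 2 := by ring
  simp [Uplus, Kplus, Kbdry, sigmaYop, Matrix.mul_apply, Fin.sum_univ_two, hη,
    Algebra.algebraMap_eq_smul_one, smul_smul]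
  simp only [← mul_assoc I I, I_mul_I]
  module

/-- The boundary creation operator `𝓑(λ) = U⁺(λ)₁₂` reduces to the operators of the
periodic chain. -/
theorem Bop_reduction (L : ℕ) (η : ℂ) (s : Fin L → ℂ) (ξp : ℂ) (hξ : sinh ξp ≠ 0)
    (lam : ℂ) (hc : cosh (lam + η / 2) ≠ 0) (hs : sinh (2 * lam) ≠ 0) :
    Uplus L η s ξp lam 0 1 =
      (1 / (2 * cosh (lam + η / 2) * sinh ξp) * (sinh (2 * lam + η) / sinh (2 * lam))) •
        (sinh (lam - η / 2 + ξp) •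
            (Tmono L η s (lam - η / 2) 0 1 * Tmono L η s (-lam - η / 2) 1 1) +
          sinh (lam + η / 2 - ξp) •
            (Tmono L η s (-lam - η / 2) 0 1 * Tmono L η s (lam - η / 2) 1 1)) := by
  have hD := Tmono_D_mul_B L η s (lam - η / 2) (-lam - η / 2)
  rw [show lam - η / 2 - (-lam - η / 2) = 2 * lam by ring] at hD
  have hk := sinh_mul_sinh_add (2 * lam) (lam - η / 2 + ξp) η
  rw [show lam - η / 2 + ξp + η = lam + η / 2 + ξp by ring,
    show 2 * lam - (lam - η / 2 + ξp) = lam + η / 2 - ξp by ring] at hk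
  rw [Uplus_zero_one, (eq_inv_smul_iff₀ hs).2 hD]
  generalize sinh (lam + η / 2 + ξp) = α at hk ⊢
  generalize sinh (lam - η / 2 + ξp) = γ at hk ⊢
  generalize sinh (lam + η / 2 - ξp) = β at hk ⊢
  generalize cosh (lam + η / 2) = c at hc ⊢
  match_scalars
  · field_simp
    linear_combination hk
  · field_simp
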